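/- Let (R, m) be a reduced commutative Noetherian local ring of prime characteristic p and Krull dimension d in which every ideal is Frobenius closed (e.g. R is F-pure). Let J ⊆ m be a reduction of m generated by d elements, and assume J contains a nonzerodivisor. Then m^{d+1} ⊆ J. -/

import Mathlib

open IsLocalRing

/-- The Frobenius power `I^{[q]}`: the ideal generated by the `q`-th powers of
the elements of `I`. -/
def frobeniusPower {R : Type*} [CommRing R] (I : Ideal R) (q : ℕ) : Ideal R :=
  Ideal.span ((fun a => a ^ q) '' (I : Set R))

/-- Every ideal of `R` is Frobenius closed: for every ideal `I`, every `x` and every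
`q = p^e` with `e ≥ 1`, `x^q ∈ I^{[q]}` implies `x ∈ I`. -/
def AllIdealsFrobeniusClosed (R : Type*) [CommRing R] (p : ℕ) : Prop :=
  ∀ (I : Ideal R) (x : R) (e : ℕ), 1 ≤ e → x ^ (p ^ e) ∈ frobeniusPower I (p ^ e) → x ∈ I

/-- `J` is a reduction of `I`: `J ⊆ I` and `I^{n+1} = J·I^n` for some `n ≥ 0`. -/
def IsReduction {R : Type*} [CommRing R] (J I : Ideal R) : Prop :=
  J ≤ I ∧ ∃ n : ℕ, I ^ (n + 1) = J * I ^ n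

/-- A pigeonhole bound: a sufficiently high power of a finitely generated ideal is contained in
the ideal generated by the `q`-th powers of the generators. -/
theorem Ideal.span_finset_pow_le_span_image_pow {R : Type*} [CommRing R] (s : Finset R) (q : ℕ) :
    Ideal.span (s : Set R) ^ (s.card * q + 1) ≤ Ideal.span ((fun a => a ^ q) '' (s : Set R)) := by
  classical
  induction s using Finset.induction_on with
  | empty => simp
  | insert a s ha ih =>
    rw [Finset.card_insert_of_notMem ha, Finset.coe_insert, Ideal.span_insert, Set.image_insert_eq,
      Ideal.span_insert, show (s.card + 1) * q + 1 = q + (s.card * q + 1) by ring]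
    refine Ideal.sup_pow_add_le_pow_sup_pow.trans (sup_le_sup ?_ ih)
    rw [Ideal.span_singleton_pow]

theorem Ideal.pow_add_le_pow_of_pow_succ_eq_mul {R : Type*} [CommRing R] {I J : Ideal R} {n : ℕ}
    (h : I ^ (n + 1) = J * I ^ n) (k : ℕ) : I ^ (n + k) ≤ J ^ k := by
  suffices I ^ (n + k) = J ^ k * I ^ n from this ▸ Ideal.mul_le_left
  induction k with
  | zero => simp
  | succ k ih => rw [← add_assoc, pow_succ, ih, mul_assoc, ← pow_succ, h, ← mul_assoc, ← pow_succ]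

/-- Let `(R, m)` be a reduced Noetherian local ring of prime
characteristic `p` and Krull dimension `d` in which every ideal is Frobenius closed.
If `J ⊆ m` is a reduction of `m` generated by `d` elements and containing a
nonzerodivisor, then `m^{d+1} ⊆ J`. -/
theorem maximalIdeal_pow_dim_succ_le_reduction_of_frobeniusClosed
    {R : Type*} [CommRing R] [IsNoetherianRing R] [IsLocalRing R] [IsReduced R]
    (p : ℕ) [Fact p.Prime] [CharP R p]
    (d : ℕ) (hdim : ringKrullDim R = d)
    (hFC : AllIdealsFrobeniusClosed R p)
    (J : Ideal R) (hred : IsReduction J (maximalIdeal R))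
    (s : Finset R) (hcard : s.card = d) (hgen : J = Ideal.span s)
    (hnzd : ∃ c ∈ J, c ∈ nonZeroDivisors R) :
    maximalIdeal R ^ (d + 1) ≤ J := by
  obtain ⟨-, n, hn⟩ := hred
  intro x hx
  refine hFC J x (n + 1) (by omega) ?_
  set q := p ^ (n + 1)
  have hq : n + 1 ≤ q := (Nat.lt_pow_self (Fact.out : p.Prime).one_lt).le
  have hxq : x ^ q ∈ maximalIdeal R ^ (n + (d * q + 1)) := by
    refine Ideal.pow_le_pow_right ?_ (pow_mul (maximalIdeal R) (d + 1) q ▸ Ideal.pow_mem_pow hx q)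
    rw [add_mul]
    omega
  have hJ := Ideal.pow_add_le_pow_of_pow_succ_eq_mul hn (d * q + 1) hxq
  rw [hgen, ← hcard] at hJ
  exact Ideal.span_mono (Set.image_mono (hgen ▸ Ideal.subset_span))
    (Ideal.span_finset_pow_le_span_image_pow s q hJ)
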